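/- Let α, β, γ be the three distinct complex roots of x³ - x² - x - 1 = 0. Then for all integers n and s, (T(n+s) : ℂ) = ((α² - α)·T(s) + α·T(s+1) + T(s-1))·αⁿ/((α-γ)(α-β)) + ((β² - β)·T(s) + β·T(s+1) + T(s-1))·βⁿ/((β-γ)(β-α)) + ((γ² - γ)·T(s) + γ·T(s+1) + T(s-1))·γⁿ/((γ-β)(γ-α)). (This is the componentwise content of the alternative Binet formula for the Tribonacci sedenions obtained from their generating function.) -/

import Mathlib

/-- Two-sided sequences satisfying the Tribonacci recurrence are determined by three
consecutive values. -/
theorem eq_of_tribonacci_recurrence {R : Type*} [AddCommGroup R] {f g : ℤ → R}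
    (hf : ∀ n, f (n + 2) = f (n + 1) + f n + f (n - 1))
    (hg : ∀ n, g (n + 2) = g (n + 1) + g n + g (n - 1))
    (hneg : f (-1) = g (-1)) (h0 : f 0 = g 0) (h1 : f 1 = g 1) (n : ℤ) : f n = g n := by
  suffices h : f (n - 1) = g (n - 1) ∧ f n = g n ∧ f (n + 1) = g (n + 1) from h.2.1
  induction n using Int.induction_on with
  | zero => simpa using ⟨hneg, h0, h1⟩
  | succ k ih =>
    obtain ⟨ha, hb, hc⟩ := ih
    refine ⟨by simpa using hb, hc, ?_⟩
    rw [add_assoc, one_add_one_eq_two, hf, hg, ha, hb, hc]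
  | pred k ih =>
    obtain ⟨ha, hb, hc⟩ := ih
    refine ⟨?_, ha, by simpa using hb⟩
    have hf' := hf (-k - 1)
    have hg' := hg (-k - 1)
    rw [show (-k - 1 + 2 : ℤ) = -k + 1 by ring, sub_add_cancel] at hf' hg'
    rw [hc, hb, ha, hg'] at hf'
    exact (add_left_cancel hf').symm

/-- A nonzero root of `x ^ 3 - x ^ 2 - x - 1` has powers obeying the Tribonacci recurrence. -/
theorem zpow_tribonacci_recurrence {K : Type*} [Field K] {x : K} (hx : x ≠ 0)
    (h : x ^ 3 = x ^ 2 + x + 1) (n : ℤ) :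
    x ^ (n + 2) = x ^ (n + 1) + x ^ n + x ^ (n - 1) := by
  have e (k : ℕ) : x ^ (n - 1 + k) = x ^ (n - 1) * x ^ k := by
    rw [zpow_add₀ hx, zpow_natCast]
  have e1 := e 1
  have e2 := e 2
  have e3 := e 3
  rw [show n - 1 + ((1 : ℕ) : ℤ) = n by push_cast; ring] at e1
  rw [show n - 1 + ((2 : ℕ) : ℤ) = n + 1 by push_cast; ring] at e2
  rw [show n - 1 + ((3 : ℕ) : ℤ) = n + 2 by push_cast; ring] at e3
  rw [e1, e2, e3]
  linear_combination x ^ (n - 1) * h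


/-- Alternative Binet formula for shifted Tribonacci numbers. -/
theorem tribonacci_alt_binet (T : ℤ → ℤ) (hT0 : T 0 = 0) (hT1 : T 1 = 1) (hT2 : T 2 = 1)
    (hTrec : ∀ n : ℤ, T n = T (n - 1) + T (n - 2) + T (n - 3))
    (α β γ : ℂ) (hαβ : α ≠ β) (hαγ : α ≠ γ) (hβγ : β ≠ γ)
    (hroots : ∀ x : ℂ, (x - α) * (x - β) * (x - γ) = x ^ 3 - x ^ 2 - x - 1)
    (n s : ℤ) :
    (T (n + s) : ℂ)
      = ((α ^ 2 - α) * (T s : ℂ) + α * (T (s + 1) : ℂ) + (T (s - 1) : ℂ)) * α ^ n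
          / ((α - γ) * (α - β))
        + ((β ^ 2 - β) * (T s : ℂ) + β * (T (s + 1) : ℂ) + (T (s - 1) : ℂ)) * β ^ n
          / ((β - γ) * (β - α))
        + ((γ ^ 2 - γ) * (T s : ℂ) + γ * (T (s + 1) : ℂ) + (T (s - 1) : ℂ)) * γ ^ n
          / ((γ - β) * (γ - α)) := by
  have p0 : α * β * γ = 1 := by linear_combination -hroots 0
  have hα : α ≠ 0 := by rintro rfl; simp at p0
  have hβ : β ≠ 0 := by rintro rfl; simp at p0
  have hγ : γ ≠ 0 := by rintro rfl; simp at p0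
  have p1 : α + β + γ = 1 := by
    linear_combination hroots 0 - hroots 1 / 2 - hroots (-1) / 2
  have rα := zpow_tribonacci_recurrence hα (by linear_combination -hroots α)
  have rβ := zpow_tribonacci_recurrence hβ (by linear_combination -hroots β)
  have rγ := zpow_tribonacci_recurrence hγ (by linear_combination -hroots γ)
  have d1 := sub_ne_zero.2 hαβ
  have d2 := sub_ne_zero.2 hαγ
  have d3 := sub_ne_zero.2 hβγ
  have nβα : β - α = -(α - β) := by ring
  have nγα : γ - α = -(α - γ) := by ring
  have nγβ : γ - β = -(β - γ) := by ring
  have s0 : 1 / ((α - γ) * (α - β)) + 1 / ((β - γ) * (β - α)) + 1 / ((γ - β) * (γ - α)) = 0 := by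
    rw [nβα, nγα, nγβ]; field_simp; ring
  have s1 : α / ((α - γ) * (α - β)) + β / ((β - γ) * (β - α)) + γ / ((γ - β) * (γ - α)) = 0 := by
    rw [nβα, nγα, nγβ]; field_simp; ring
  have s2 : α ^ 2 / ((α - γ) * (α - β)) + β ^ 2 / ((β - γ) * (β - α))
      + γ ^ 2 / ((γ - β) * (γ - α)) = 1 := by
    rw [nβα, nγα, nγβ]; field_simp; ring
  have s3 : α ^ 3 / ((α - γ) * (α - β)) + β ^ 3 / ((β - γ) * (β - α))
      + γ ^ 3 / ((γ - β) * (γ - α)) = 1 := by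
    rw [← p1, nβα, nγα, nγβ]; field_simp; ring
  have sneg : β * γ / ((α - γ) * (α - β)) + α * γ / ((β - γ) * (β - α))
      + α * β / ((γ - β) * (γ - α)) = 1 := by
    rw [nβα, nγα, nγβ]; field_simp; ring
  refine eq_of_tribonacci_recurrence (f := fun m ↦ (T (m + s) : ℂ))
    (g := fun m ↦ ((α ^ 2 - α) * (T s : ℂ) + α * (T (s + 1) : ℂ) + (T (s - 1) : ℂ)) * α ^ m
          / ((α - γ) * (α - β))
        + ((β ^ 2 - β) * (T s : ℂ) + β * (T (s + 1) : ℂ) + (T (s - 1) : ℂ)) * β ^ m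
          / ((β - γ) * (β - α))
        + ((γ ^ 2 - γ) * (T s : ℂ) + γ * (T (s + 1) : ℂ) + (T (s - 1) : ℂ)) * γ ^ m
          / ((γ - β) * (γ - α))) (fun m ↦ ?_) (fun m ↦ ?_) ?_ ?_ ?_ n
  · have h := hTrec (m + 2 + s)
    rw [show m + 2 + s - 1 = m + 1 + s by ring, show m + 2 + s - 2 = m + s by ring,
      show m + 2 + s - 3 = m - 1 + s by ring] at h
    exact_mod_cast h
  · simp only [rα, rβ, rγ]
    ring
  · have iα : α ^ (-1 : ℤ) = β * γ := by
      rw [zpow_neg_one]; exact inv_eq_of_mul_eq_one_right (by linear_combination p0)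
    have iβ : β ^ (-1 : ℤ) = α * γ := by
      rw [zpow_neg_one]; exact inv_eq_of_mul_eq_one_right (by linear_combination p0)
    have iγ : γ ^ (-1 : ℤ) = α * β := by
      rw [zpow_neg_one]; exact inv_eq_of_mul_eq_one_right (by linear_combination p0)
    have hm (x y t : ℂ) (h : x * y = 1) : ((x ^ 2 - x) * (T s : ℂ) + x * (T (s + 1) : ℂ) + t) * y
        = (x - 1) * T s + T (s + 1) + t * y := by
      linear_combination ((x - 1) * T s + T (s + 1)) * h
    simp only [iα, iβ, iγ]
    rw [hm α _ _ (by linear_combination p0), hm β _ _ (by linear_combination p0),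
      hm γ _ _ (by linear_combination p0), neg_add_eq_sub]
    linear_combination -(T s : ℂ) * (s1 - s0) - T (s + 1) * s0 - T (s - 1) * sneg
  · simp only [zpow_zero, zero_add]
    linear_combination -(T s : ℂ) * (s2 - s1) - T (s + 1) * s1 - T (s - 1) * s0
  · simp only [zpow_one, add_comm 1 s]
    linear_combination -(T s : ℂ) * (s3 - s2) - T (s + 1) * s2 - T (s - 1) * s1
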